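/- (Theorem 2) Fix reals g and b (the branch conductance and susceptance) and take α_c = −g and α_s = b, so that φ(x₁,x₂,x₃,x₄) = −g x₁x₂x₃ + b x₁x₂x₄ is the non-convex term of the reactive power flow q = −b v_i² − g v_i v_j ĉs + b v_i v_j ŝn (with x₁ = v_i, x₂ = v_j the voltage magnitudes, x₃ the lifted cosine variable, x₄ the lifted sine variable). If l₁ < u₁ and l₂ < u₂, then the strengthened (TLM) relaxation set S_QC equals the convex hull of the graph of this term over the box: S_QC = convexHull ℝ {(−g x₁x₂x₃ + b x₁x₂x₄, x₁, x₂, x₃, x₄) : (x₁,x₂,x₃,x₄) ∈ B}. -/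

import Mathlib

open Finset Real

noncomputable section

/-- Vertices of the box `[l1,u1] × [l2,u2] × [l3,u3]` in lexicographic order. -/
def xiC (l1 u1 l2 u2 l3 u3 : ℝ) : Fin 8 → ℝ × ℝ × ℝ :=
  ![(l1, l2, l3), (l1, l2, u3), (l1, u2, l3), (l1, u2, u3),
    (u1, l2, l3), (u1, l2, u3), (u1, u2, l3), (u1, u2, u3)]

/-- The trilinear product of the coordinates of a point of `ℝ³`. -/
def tri (p : ℝ × ℝ × ℝ) : ℝ := p.1 * p.2.1 * p.2.2

/-- The linking constraint between the multipliers `lc` and `ls`. -/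
def Linking (l1 u1 l2 u2 : ℝ) (lc ls : Fin 8 → ℝ) : Prop :=
    (lc 0 + lc 1 - ls 0 - ls 1) * (l1 * l2)
  + (lc 2 + lc 3 - ls 2 - ls 3) * (l1 * u2)
  + (lc 4 + lc 5 - ls 4 - ls 5) * (u1 * l2)
  + (lc 6 + lc 7 - ls 6 - ls 7) * (u1 * u2) = 0

/-- The sum of two trilinear terms sharing the first two variables. -/
def phi (ac as : ℝ) (x : ℝ × ℝ × ℝ × ℝ) : ℝ :=
  ac * (x.1 * x.2.1 * x.2.2.1) + as * (x.1 * x.2.1 * x.2.2.2)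

/-- The box `B = [l1,u1] × [l2,u2] × [l3,u3] × [l4,u4] ⊆ ℝ⁴`. -/
def boxB (l1 u1 l2 u2 l3 u3 l4 u4 : ℝ) : Set (ℝ × ℝ × ℝ × ℝ) :=
  {x | x.1 ∈ Set.Icc l1 u1 ∧ x.2.1 ∈ Set.Icc l2 u2 ∧
       x.2.2.1 ∈ Set.Icc l3 u3 ∧ x.2.2.2 ∈ Set.Icc l4 u4}

/-- The set of vertices of the box `B`. -/
def vertB (l1 u1 l2 u2 l3 u3 l4 u4 : ℝ) : Set (ℝ × ℝ × ℝ × ℝ) :=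
  {x | (x.1 = l1 ∨ x.1 = u1) ∧ (x.2.1 = l2 ∨ x.2.1 = u2) ∧
       (x.2.2.1 = l3 ∨ x.2.2.1 = u3) ∧ (x.2.2.2 = l4 ∨ x.2.2.2 = u4)}

/-- The strengthened (TLM) relaxation set `S_QC ⊆ ℝ⁵`. -/
def SQC (l1 u1 l2 u2 l3 u3 l4 u4 ac as : ℝ) : Set (ℝ × ℝ × ℝ × ℝ × ℝ) :=
  {p | ∃ lc ls : Fin 8 → ℝ,
    lc ∈ stdSimplex ℝ (Fin 8) ∧ ls ∈ stdSimplex ℝ (Fin 8) ∧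
    (p.2.1, p.2.2.1, p.2.2.2.1) = ∑ k, lc k • xiC l1 u1 l2 u2 l3 u3 k ∧
    (p.2.1, p.2.2.1, p.2.2.2.2) = ∑ k, ls k • xiC l1 u1 l2 u2 l4 u4 k ∧
    p.1 = ac * ∑ k, lc k * tri (xiC l1 u1 l2 u2 l3 u3 k)
        + as * ∑ k, ls k * tri (xiC l1 u1 l2 u2 l4 u4 k) ∧
    Linking l1 u1 l2 u2 lc ls}

/-- `S`: the convex hull of the 16 points `(φ(γ), γ)`, `γ` a vertex of `B`. -/
def Shull (l1 u1 l2 u2 l3 u3 l4 u4 ac as : ℝ) : Set (ℝ × ℝ × ℝ × ℝ × ℝ) :=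
  convexHull ℝ ((fun x => (phi ac as x, x)) '' vertB l1 u1 l2 u2 l3 u3 l4 u4)

/-- A point of `[l, u]` is a convex combination of the end points. -/
lemma exists_eq_segment_of_mem_Icc {l u x : ℝ} (hx : x ∈ Set.Icc l u) :
    ∃ t : ℝ, 0 ≤ t ∧ 0 ≤ 1 - t ∧ x = (1 - t) * l + t * u := by
  have hlu : l ≤ u := hx.1.trans hx.2
  rw [← segment_eq_Icc hlu] at hx
  obtain ⟨a, t, ha, ht, hat, rfl⟩ := hx
  obtain rfl : a = 1 - t := by linarith
  exact ⟨t, ht, ha, by simp⟩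

/-- A nonnegative combination of `l` and `u` is its total weight times a point of `[l, u]`. -/
lemma exists_mem_Icc_add_mul_eq {l u p q : ℝ} (hlu : l ≤ u) (hp : 0 ≤ p) (hq : 0 ≤ q) :
    ∃ c ∈ Set.Icc l u, (p + q) * c = p * l + q * u := by
  rcases (add_nonneg hp hq).eq_or_lt with h | h
  · obtain rfl : p = 0 := by linarith
    obtain rfl : q = 0 := by linarith
    exact ⟨l, ⟨le_rfl, hlu⟩, by simp⟩
  · refine ⟨(p * l + q * u) / (p + q), ⟨?_, ?_⟩, by field_simp⟩
    · rw [le_div_iff₀ h]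
      nlinarith
    · rw [div_le_iff₀ h]
      nlinarith

/-- Weights on the vertices of a nondegenerate rectangle are determined by their sum and by the
first moments and the mixed moment of the two coordinates. -/
lemma rectangle_weights_eq_zero {l1 u1 l2 u2 a b c d : ℝ} (h1 : l1 < u1) (h2 : l2 < u2)
    (hs : a + b + c + d = 0)
    (hx : (a + b) * l1 + (c + d) * u1 = 0)
    (hy : (a + c) * l2 + (b + d) * u2 = 0)
    (hxy : a * (l1 * l2) + b * (l1 * u2) + c * (u1 * l2) + d * (u1 * u2) = 0) :
    a = 0 ∧ b = 0 ∧ c = 0 ∧ d = 0 := by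
  have e1 : u1 - l1 ≠ 0 := (sub_pos.2 h1).ne'
  have e2 : u2 - l2 ≠ 0 := (sub_pos.2 h2).ne'
  have hcd : c + d = 0 := mul_right_cancel₀ e1 (by linear_combination hx - l1 * hs)
  have hbd : b + d = 0 := mul_right_cancel₀ e2 (by linear_combination hy - l2 * hs)
  have hd : d = 0 := mul_right_cancel₀ (mul_ne_zero e1 e2)
    (by linear_combination hxy - l1 * hy - l2 * hx + l1 * l2 * hs)
  exact ⟨by linarith, by linarith, by linarith, hd⟩

/-- The coordinatewise description of membership in `SQC`. -/
lemma mem_SQC_iff {l1 u1 l2 u2 l3 u3 l4 u4 ac as z x1 x2 x3 x4 : ℝ} :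
    (z, x1, x2, x3, x4) ∈ SQC l1 u1 l2 u2 l3 u3 l4 u4 ac as ↔ ∃ lc ls : Fin 8 → ℝ,
      (∀ k, 0 ≤ lc k) ∧ (∀ k, 0 ≤ ls k) ∧
      lc 0 + lc 1 + lc 2 + lc 3 + lc 4 + lc 5 + lc 6 + lc 7 = 1 ∧
      ls 0 + ls 1 + ls 2 + ls 3 + ls 4 + ls 5 + ls 6 + ls 7 = 1 ∧
      x1 = (lc 0 + lc 1 + lc 2 + lc 3) * l1 + (lc 4 + lc 5 + lc 6 + lc 7) * u1 ∧
      x2 = (lc 0 + lc 1 + lc 4 + lc 5) * l2 + (lc 2 + lc 3 + lc 6 + lc 7) * u2 ∧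
      x3 = (lc 0 + lc 2 + lc 4 + lc 6) * l3 + (lc 1 + lc 3 + lc 5 + lc 7) * u3 ∧
      x1 = (ls 0 + ls 1 + ls 2 + ls 3) * l1 + (ls 4 + ls 5 + ls 6 + ls 7) * u1 ∧
      x2 = (ls 0 + ls 1 + ls 4 + ls 5) * l2 + (ls 2 + ls 3 + ls 6 + ls 7) * u2 ∧
      x4 = (ls 0 + ls 2 + ls 4 + ls 6) * l4 + (ls 1 + ls 3 + ls 5 + ls 7) * u4 ∧
      z = ac * (l1 * l2 * (lc 0 * l3 + lc 1 * u3) + l1 * u2 * (lc 2 * l3 + lc 3 * u3)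
            + u1 * l2 * (lc 4 * l3 + lc 5 * u3) + u1 * u2 * (lc 6 * l3 + lc 7 * u3))
        + as * (l1 * l2 * (ls 0 * l4 + ls 1 * u4) + l1 * u2 * (ls 2 * l4 + ls 3 * u4)
            + u1 * l2 * (ls 4 * l4 + ls 5 * u4) + u1 * u2 * (ls 6 * l4 + ls 7 * u4)) ∧
      Linking l1 u1 l2 u2 lc ls := by
  simp only [SQC, Set.mem_ofPred_eq, stdSimplex, Fin.sum_univ_eight, xiC, tri, Prod.ext_iff]
  simp only [Prod.fst_add, Prod.snd_add, Prod.smul_fst, Prod.smul_snd, smul_eq_mul,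
    Matrix.cons_val]
  refine exists_congr fun lc => exists_congr fun ls => ⟨?_, ?_⟩
  · rintro ⟨⟨a1, a2⟩, ⟨a3, a4⟩, ⟨e1, e2, e3⟩, ⟨e4, e5, e6⟩, e7, e8⟩
    refine ⟨a1, a3, a2, a4, ?_, ?_, ?_, ?_, ?_, ?_, ?_, e8⟩ <;> linarith
  · rintro ⟨a1, a3, a2, a4, e1, e2, e3, e4, e5, e6, e7, e8⟩
    refine ⟨⟨a1, a2⟩, ⟨a3, a4⟩, ⟨?_, ?_, ?_⟩, ⟨?_, ?_, ?_⟩, ?_, e8⟩ <;> linarith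

/-- The relaxation set is convex. -/
lemma convex_SQC (l1 u1 l2 u2 l3 u3 l4 u4 ac as : ℝ) :
    Convex ℝ (SQC l1 u1 l2 u2 l3 u3 l4 u4 ac as) := by
  rintro p ⟨lc, ls, hlc, hls, hc, hs, hz, hL⟩ q ⟨mc, ms, hmc, hms, kc, ks, kz, kL⟩ a b ha hb hab
  refine ⟨a • lc + b • mc, a • ls + b • ms, convex_stdSimplex ℝ _ hlc hmc ha hb hab,
    convex_stdSimplex ℝ _ hls hms ha hb hab, ?_, ?_, ?_, ?_⟩
  · simp only [Pi.add_apply, Pi.smul_apply, smul_eq_mul, add_smul, mul_smul, sum_add_distrib,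
      ← smul_sum]
    rw [← hc, ← kc]
    rfl
  · simp only [Pi.add_apply, Pi.smul_apply, smul_eq_mul, add_smul, mul_smul, sum_add_distrib,
      ← smul_sum]
    rw [← hs, ← ks]
    rfl
  · simp only [Pi.add_apply, Pi.smul_apply, smul_eq_mul, add_mul, mul_assoc, sum_add_distrib,
      ← mul_sum, Prod.fst_add, Prod.smul_fst]
    rw [hz, kz]
    ring
  · simp only [Linking, Pi.add_apply, Pi.smul_apply, smul_eq_mul] at hL kL ⊢
    linear_combination a * hL + b * kL

/-- The graph of `phi` over the box lies in the relaxation set. -/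
lemma graph_mem_SQC {l1 u1 l2 u2 l3 u3 l4 u4 : ℝ} (ac as : ℝ) {x : ℝ × ℝ × ℝ × ℝ}
    (hx : x ∈ boxB l1 u1 l2 u2 l3 u3 l4 u4) :
    (phi ac as x, x) ∈ SQC l1 u1 l2 u2 l3 u3 l4 u4 ac as := by
  obtain ⟨x1, x2, x3, x4⟩ := x
  obtain ⟨hx1, hx2, hx3, hx4⟩ := hx
  obtain ⟨t1, p1, q1, e1⟩ := exists_eq_segment_of_mem_Icc hx1
  obtain ⟨t2, p2, q2, e2⟩ := exists_eq_segment_of_mem_Icc hx2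
  obtain ⟨t3, p3, q3, e3⟩ := exists_eq_segment_of_mem_Icc hx3
  obtain ⟨t4, p4, q4, e4⟩ := exists_eq_segment_of_mem_Icc hx4
  dsimp only at e1 e2 e3 e4
  subst e1 e2 e3 e4
  let w : ℝ → Fin 8 → ℝ := fun t =>
    ![(1 - t1) * (1 - t2) * (1 - t), (1 - t1) * (1 - t2) * t,
      (1 - t1) * t2 * (1 - t), (1 - t1) * t2 * t,
      t1 * (1 - t2) * (1 - t), t1 * (1 - t2) * t, t1 * t2 * (1 - t), t1 * t2 * t]
  have hw : ∀ t, 0 ≤ t → 0 ≤ 1 - t → ∀ k, 0 ≤ w t k := by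
    intro t ht ht' k
    fin_cases k <;> exact mul_nonneg (mul_nonneg ‹_› ‹_›) ‹_›
  refine mem_SQC_iff.2 ⟨w t3, w t4, hw t3 p3 q3, hw t4 p4 q4, ?_⟩
  simp only [w, Linking, phi, Matrix.cons_val]
  refine ⟨?_, ?_, ?_, ?_, ?_, ?_, ?_, ?_, ?_, ?_⟩ <;> ring

/-- When the first two sides of the box are nondegenerate, the relaxation set lies in the convex
hull of the graph of `phi` over the box. -/
lemma SQC_subset_convexHull_graph {l1 u1 l2 u2 l3 u3 l4 u4 : ℝ} (ac as : ℝ)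
    (h1 : l1 < u1) (h2 : l2 < u2) (h3 : l3 ≤ u3) (h4 : l4 ≤ u4) :
    SQC l1 u1 l2 u2 l3 u3 l4 u4 ac as ⊆
      convexHull ℝ ((fun x => (phi ac as x, x)) '' boxB l1 u1 l2 u2 l3 u3 l4 u4) := by
  rintro ⟨z, x1, x2, x3, x4⟩ hp
  obtain ⟨lc, ls, hc, hs, c1, s1, ec1, ec2, ec3, es1, es2, es3, ez, hL⟩ := mem_SQC_iff.1 hp
  unfold Linking at hL
  obtain ⟨w0, w1, w2, w3⟩ := rectangle_weights_eq_zero h1 h2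
    (a := lc 0 + lc 1 - ls 0 - ls 1) (b := lc 2 + lc 3 - ls 2 - ls 3)
    (c := lc 4 + lc 5 - ls 4 - ls 5) (d := lc 6 + lc 7 - ls 6 - ls 7)
    (by linarith) (by linarith) (by linarith) hL
  obtain ⟨c0, hc0, ec0⟩ := exists_mem_Icc_add_mul_eq h3 (hc 0) (hc 1)
  obtain ⟨c2, hc2, ec2'⟩ := exists_mem_Icc_add_mul_eq h3 (hc 2) (hc 3)
  obtain ⟨c4, hc4, ec4⟩ := exists_mem_Icc_add_mul_eq h3 (hc 4) (hc 5)
  obtain ⟨c6, hc6, ec6⟩ := exists_mem_Icc_add_mul_eq h3 (hc 6) (hc 7)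
  obtain ⟨s0, hs0, es0⟩ := exists_mem_Icc_add_mul_eq h4 (hs 0) (hs 1)
  obtain ⟨s2, hs2, es2'⟩ := exists_mem_Icc_add_mul_eq h4 (hs 2) (hs 3)
  obtain ⟨s4, hs4, es4⟩ := exists_mem_Icc_add_mul_eq h4 (hs 4) (hs 5)
  obtain ⟨s6, hs6, es6⟩ := exists_mem_Icc_add_mul_eq h4 (hs 6) (hs 7)
  rw [show ls 0 + ls 1 = lc 0 + lc 1 by linarith] at es0
  rw [show ls 2 + ls 3 = lc 2 + lc 3 by linarith] at es2'
  rw [show ls 4 + ls 5 = lc 4 + lc 5 by linarith] at es4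
  rw [show ls 6 + ls 7 = lc 6 + lc 7 by linarith] at es6
  have m1 : l1 ∈ Set.Icc l1 u1 := ⟨le_rfl, h1.le⟩
  have m1' : u1 ∈ Set.Icc l1 u1 := ⟨h1.le, le_rfl⟩
  have m2 : l2 ∈ Set.Icc l2 u2 := ⟨le_rfl, h2.le⟩
  have m2' : u2 ∈ Set.Icc l2 u2 := ⟨h2.le, le_rfl⟩
  let w : Fin 4 → ℝ := ![lc 0 + lc 1, lc 2 + lc 3, lc 4 + lc 5, lc 6 + lc 7]
  let y : Fin 4 → ℝ × ℝ × ℝ × ℝ :=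
    ![(l1, l2, c0, s0), (l1, u2, c2, s2), (u1, l2, c4, s4), (u1, u2, c6, s6)]
  have hw : ∀ k ∈ (univ : Finset (Fin 4)), 0 ≤ w k := by
    intro k _
    fin_cases k <;> exact add_nonneg (hc _) (hc _)
  have hsum : ∑ k, w k = 1 := by
    simp only [Fin.sum_univ_four, w, Matrix.cons_val]
    linarith
  have hy : ∀ k, y k ∈ boxB l1 u1 l2 u2 l3 u3 l4 u4 := by
    intro k
    fin_cases k
    exacts [⟨m1, m2, hc0, hs0⟩, ⟨m1, m2', hc2, hs2⟩, ⟨m1', m2, hc4, hs4⟩, ⟨m1', m2', hc6, hs6⟩]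
  have key := (convex_convexHull ℝ
    ((fun x => (phi ac as x, x)) '' boxB l1 u1 l2 u2 l3 u3 l4 u4)).sum_mem hw hsum
    fun k _ => subset_convexHull ℝ _ (Set.mem_image_of_mem _ (hy k))
  convert key using 1
  simp only [Fin.sum_univ_four, w, y, phi, Prod.ext_iff, Prod.fst_add, Prod.snd_add,
    Prod.smul_fst, Prod.smul_snd, smul_eq_mul, Matrix.cons_val]
  refine ⟨?_, ?_, ?_, ?_, ?_⟩
  · rw [ez, ← ec0, ← ec2', ← ec4, ← ec6, ← es0, ← es2', ← es4, ← es6]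
    ring
  all_goals linarith

/-- Theorem 2: with `α_c = -g`, `α_s = b`, the strengthened (TLM)
relaxation set equals the convex hull of the graph of the non-convex reactive-power
term `-g x₁x₂x₃ + b x₁x₂x₄` over the box `B`. -/
theorem SQC_eq_convexHull_reactive_power (l1 u1 l2 u2 l3 u3 l4 u4 g b : ℝ)
    (h1 : l1 < u1) (h2 : l2 < u2) (h3 : l3 ≤ u3) (h4 : l4 ≤ u4) :
    SQC l1 u1 l2 u2 l3 u3 l4 u4 (-g) b =
      convexHull ℝ
        ((fun x : ℝ × ℝ × ℝ × ℝ =>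
            (-g * (x.1 * x.2.1 * x.2.2.1) + b * (x.1 * x.2.1 * x.2.2.2), x)) ''
          boxB l1 u1 l2 u2 l3 u3 l4 u4) :=
  (SQC_subset_convexHull_graph (-g) b h1 h2 h3 h4).antisymm <|
    convexHull_min (Set.image_subset_iff.2 fun _ hx => graph_mem_SQC (-g) b hx)
      (convex_SQC l1 u1 l2 u2 l3 u3 l4 u4 (-g) b)
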